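/- arXiv:1307.3215 — 6 statements merged into one kernel-verified Lean document; each statement's English description precedes it below -/
import Mathlib

section
/- The cubic surface S₁ contains no line defined over 𝔽₂: there is no 2-dimensional 𝔽₂-linear subspace W of 𝔽₂⁴ such that f₁ vanishes at every vector of W. -/
open MvPolynomial

/-- The cubic form `Y³ + Y²Z + Z³ + W(X² + Y² + YZ + Z²) + XW² + W³` with the variables
`X, Y, Z, W` indexed by `0, 1, 2, 3`, over any commutative ring (its coefficients lie in `𝔽₂`). -/
noncomputable def f₁ (K : Type*) [CommRing K] : MvPolynomial (Fin 4) K :=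
  X 1 ^ 3 + X 1 ^ 2 * X 2 + X 2 ^ 3
    + X 3 * (X 0 ^ 2 + X 1 ^ 2 + X 1 * X 2 + X 2 ^ 2) + X 0 * X 3 ^ 2 + X 3 ^ 3

/-- The only point of `S₁` over `𝔽₂` is `[1 : 0 : 0 : 0]`. -/
theorem coords_eq_zero_of_eval_f₁_eq_zero (v : Fin 4 → ZMod 2)
    (hv : eval v (f₁ (ZMod 2)) = 0) : v 1 = 0 ∧ v 2 = 0 ∧ v 3 = 0 := by
  have key : ∀ a b c d : ZMod 2,
      b ^ 3 + b ^ 2 * c + c ^ 3 + d * (a ^ 2 + b ^ 2 + b * c + c ^ 2) + a * d ^ 2 + d ^ 3 = 0 →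
        b = 0 ∧ c = 0 ∧ d = 0 := by
    decide
  exact key (v 0) (v 1) (v 2) (v 3) (by simpa [f₁] using hv)

/-- The cubic surface `S₁` contains no line defined over `𝔽₂`. -/
theorem S₁_no_line_over_F2 :
    ¬ ∃ W : Submodule (ZMod 2) (Fin 4 → ZMod 2),
        Module.finrank (ZMod 2) W = 2 ∧ ∀ v ∈ W, eval v (f₁ (ZMod 2)) = 0 := by
  rintro ⟨W, hW, hf⟩
  have hle : W ≤ Submodule.span (ZMod 2) {Pi.single 0 1} := by
    intro v hv
    obtain ⟨h₁, h₂, h₃⟩ := coords_eq_zero_of_eval_f₁_eq_zero v (hf v hv)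
    refine Submodule.mem_span_singleton.mpr ⟨v 0, ?_⟩
    ext i
    fin_cases i <;> simp [h₁, h₂, h₃]
  have hrank := Submodule.finrank_mono hle
  rw [hW, finrank_span_singleton (by simp)] at hrank
  omega
end

section
/- The cubic surface S₁ has exactly 9 points over the field 𝔽₄ with four elements: the number of points [v] of ℙ³(𝔽₄) with f₁(v) = 0 equals 9 (equivalently, the number of nonzero vectors v ∈ 𝔽₄⁴ with f₁(v) = 0 equals 27). -/
open MvPolynomial

/-- The number of nonzero vectors satisfying a scaling-invariant predicate is the number of points
of projective space satisfying it, times the number of units. -/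
theorem Projectivization.ncard_cone {k V : Type*} [DivisionRing k] [AddCommGroup V] [Module k V]
    (p : V → Prop) (hp : ∀ (u : kˣ) (v : V), p (u • v) ↔ p v) :
    {v : V | v ≠ 0 ∧ p v}.ncard
      = {x : Projectivization k V | p x.rep}.ncard * Nat.card kˣ := by
  have himage : {v : V | v ≠ 0 ∧ p v} =
      (fun y : Projectivization k V × kˣ => y.2 • y.1.rep) ''
        ({x : Projectivization k V | p x.rep} ×ˢ Set.univ) := by
    ext v
    constructor
    · rintro ⟨hv, hpv⟩
      obtain ⟨u, hu⟩ := Projectivization.exists_smul_eq_mk_rep k v hv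
      refine ⟨(Projectivization.mk k v hv, u⁻¹), ⟨?_, Set.mem_univ _⟩, ?_⟩
      · change p (Projectivization.mk k v hv).rep
        rw [← hu]
        exact (hp u v).2 hpv
      · simp [← hu]
    · rintro ⟨⟨x, u⟩, ⟨hx, -⟩, rfl⟩
      exact ⟨(smul_ne_zero_iff_ne u).2 x.rep_nonzero, (hp u _).2 hx⟩
  have hinj : Function.Injective
      (fun y : Projectivization k V × kˣ => y.2 • y.1.rep) := by
    rintro ⟨x, u⟩ ⟨y, w⟩ h
    have h' : u • x.rep = w • y.rep := h
    have hxy : x = y := by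
      rw [← x.mk_rep, ← y.mk_rep, Projectivization.mk_eq_mk_iff]
      exact ⟨u⁻¹ * w, by rw [mul_smul, ← h', inv_smul_smul]⟩
    subst hxy
    have huw : (u : k) = w := smul_left_injective k x.rep_nonzero h'
    rw [Units.ext huw]
  rw [himage, Set.ncard_image_of_injective _ hinj, Set.ncard_prod, Set.ncard_univ]

theorem eval_f₁ {K : Type*} [CommRing K] (v : Fin 4 → K) :
    eval v (f₁ K) = v 1 ^ 3 + v 1 ^ 2 * v 2 + v 2 ^ 3
      + v 3 * (v 0 ^ 2 + v 1 ^ 2 + v 1 * v 2 + v 2 ^ 2) + v 0 * v 3 ^ 2 + v 3 ^ 3 := by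
  simp [f₁]

theorem eval_f₁_smul {K : Type*} [CommRing K] (c : K) (v : Fin 4 → K) :
    eval (c • v) (f₁ K) = c ^ 3 * eval v (f₁ K) := by
  simp only [eval_f₁, Pi.smul_apply, smul_eq_mul]
  ring

theorem ncard_cone_f₁_congr {K L : Type*} [CommRing K] [CommRing L] (e : K ≃+* L) :
    {v : Fin 4 → L | v ≠ 0 ∧ eval v (f₁ L) = 0}.ncard
      = {v : Fin 4 → K | v ≠ 0 ∧ eval v (f₁ K) = 0}.ncard := by
  have h (v : Fin 4 → K) : eval (fun i => e (v i)) (f₁ L) = e (eval v (f₁ K)) := by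
    simp [eval_f₁]
  let E : (Fin 4 → K) ≃ (Fin 4 → L) := Equiv.piCongrRight fun _ => e.toEquiv
  symm
  refine Set.ncard_congr (fun v _ => E v) ?_ (fun v w _ _ hvw => E.injective hvw) ?_
  · rintro v ⟨hv, hv'⟩
    refine ⟨fun h0 => hv (funext fun i => ?_), ?_⟩
    · exact (map_eq_zero_iff e e.injective).1 (congrFun h0 i)
    · exact (h v).trans (by rw [hv', map_zero])
  · rintro w ⟨hw, hw'⟩
    obtain ⟨v, rfl⟩ := E.surjective w
    refine ⟨v, ⟨?_, ?_⟩, rfl⟩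
    · rintro rfl
      exact hw (funext fun i => map_zero e)
    · exact (map_eq_zero_iff e e.injective).1 ((h v).symm.trans hw')

/-- The explicit model `𝔽₂[ω]`, `ω² = 1 + ω`, of the field with four elements. -/
abbrev F4Model : Type := QuadraticAlgebra (ZMod 2) 1 1

instance : Fact (∀ r : ZMod 2, r ^ 2 ≠ 1 + 1 * r) := ⟨by decide⟩

instance : Fintype F4Model := Fintype.ofEquiv _ (QuadraticAlgebra.equivProd 1 1).symm

theorem ncard_cone_f₁_F4Model :
    {v : Fin 4 → F4Model | v ≠ 0 ∧ eval v (f₁ F4Model) = 0}.ncard = 27 := by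
  simp only [eval_f₁]
  rw [Set.ncard_eq_toFinset_card', Set.toFinset_ofPred]
  decide +kernel

theorem card_F4Model : Nat.card F4Model = 2 ^ 2 := by
  rw [Nat.card_eq_fintype_card]
  decide

/-- The cubic surface `S₁` has exactly `9` points over the field `𝔽₄` with four elements
(equivalently, exactly `27` nonzero vectors of `𝔽₄⁴` lie on the affine cone). -/
theorem S₁_card_points_over_F4 :
    {x : Projectivization (GaloisField 2 2) (Fin 4 → GaloisField 2 2) |
        eval x.rep (f₁ (GaloisField 2 2)) = 0}.ncard = 9
      ∧ {v : Fin 4 → GaloisField 2 2 | v ≠ 0 ∧ eval v (f₁ (GaloisField 2 2)) = 0}.ncard = 27 := by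
  have hcone := (ncard_cone_f₁_congr
    (GaloisField.algEquivGaloisField 2 2 card_F4Model).toRingEquiv).trans ncard_cone_f₁_F4Model
  have hpoints := Projectivization.ncard_cone (k := GaloisField 2 2)
    (fun v : Fin 4 → GaloisField 2 2 => eval v (f₁ (GaloisField 2 2)) = 0) fun u v => by
      rw [Units.smul_def, eval_f₁_smul]
      simp
  rw [hcone, Nat.card_units, GaloisField.card 2 2 two_ne_zero] at hpoints
  exact ⟨by omega, hcone⟩
end

section
/- Every 𝔽₈-point of the cubic surface S₁ lies on a line of the surface defined over 𝔽₈: for every nonzero vector v ∈ 𝔽₈⁴ with f₁(v) = 0, there exists a 2-dimensional 𝔽₈-linear subspace W of 𝔽₈⁴ containing v such that f₁ vanishes at every vector of W. -/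
open MvPolynomial

/-- The span of two independent vectors is a line of the surface as soon as the form vanishes on
all their linear combinations. -/
theorem exists_line_of_pair {K : Type*} [Field K] {u v : Fin 4 → K}
    (huv : LinearIndependent K ![u, v]) (h : ∀ a b : K, eval (a • u + b • v) (f₁ K) = 0)
    (p : Fin 4 → K) (hp : ∃ a b : K, a • u + b • v = p) :
    ∃ W : Submodule K (Fin 4 → K),
      Module.finrank K W = 2 ∧ p ∈ W ∧ ∀ w ∈ W, eval w (f₁ K) = 0 := by
  refine ⟨Submodule.span K {u, v}, ?_, Submodule.mem_span_pair.2 hp, fun w hw => ?_⟩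
  · rw [← Matrix.range_cons_cons_empty u v ![], finrank_span_eq_card huv, Fintype.card_fin]
  · obtain ⟨a, b, rfl⟩ := Submodule.mem_span_pair.1 hw
    exact h a b

/-- A field with eight elements contains a root of `c³ + c² + 1`. -/
theorem exists_root_cubic {K : Type*} [Field K] [CharP K 2] (hK : Nat.card K = 8)
    (hF : ∀ x : K, x ^ 8 = x) : ∃ c : K, c ^ 3 + c ^ 2 + 1 = 0 := by
  obtain ⟨a, ha⟩ : ∃ a : K, a ∉ ({0, 1} : Set K) := by
    by_contra! h
    have hu : ({0, 1} : Set K) = Set.univ := Set.eq_univ_of_forall h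
    have := Set.ncard_insert_le (0 : K) {1}
    rw [hu, Set.ncard_univ, hK, Set.ncard_singleton] at this
    omega
  simp only [Set.mem_insert_iff, Set.mem_singleton_iff, not_or] at ha
  have h1 : a - 1 ≠ 0 := sub_ne_zero.2 ha.2
  have h : a * (a - 1) * ((a ^ 3 + a ^ 2 + 1) * (a ^ 3 + a + 1)) = 0 := by
    have := hF a
    grind
  rcases mul_eq_zero.1 ((mul_eq_zero.1 h).resolve_left (mul_ne_zero ha.1 h1)) with h | h
  · exact ⟨a, h⟩
  · refine ⟨a⁻¹, ?_⟩
    have := ha.1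
    field_simp
    linear_combination h

/-- The condition on the affine point `(x, y, z, 1)` under which some line through it in a direction
`(t, c, 1, 0)` lies on the surface, where `c³ + c² + 1 = 0`. -/
def directionResidual {K : Type*} [Field K] (y z c : K) : K :=
  (y ^ 2 * (c + 1) + z ^ 2 + y + c * z) ^ 2 + c ^ 2 * (y + z) + z + c ^ 2 + c + 1

/-- The product of the residuals over the three directions is the absolute trace of
`y³ + y²z + z³ + y² + yz + z² + 1`. -/
theorem prod_directionResidual {K : Type*} [Field K] [CharP K 2] {c y z g : K}
    (hc : c ^ 3 + c ^ 2 + 1 = 0) (hy : y ^ 8 = y) (hz : z ^ 8 = z)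
    (hg : g = y ^ 3 + y ^ 2 * z + z ^ 3 + y ^ 2 + y * z + z ^ 2 + 1) :
    directionResidual y z c * directionResidual y z (c ^ 2)
      * directionResidual y z (c ^ 2 + c + 1) = g + g ^ 2 + g ^ 4 := by
  subst hg
  unfold directionResidual
  grind

theorem exists_direction {K : Type*} [Field K] [CharP K 2] (hF : ∀ x : K, x ^ 8 = x) {c x y z : K}
    (hc : c ^ 3 + c ^ 2 + 1 = 0)
    (h : x ^ 2 + x + (y ^ 3 + y ^ 2 * z + z ^ 3 + y ^ 2 + y * z + z ^ 2 + 1) = 0) :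
    ∃ d : K, d ^ 3 + d ^ 2 + 1 = 0 ∧ directionResidual y z d = 0 := by
  set g := y ^ 3 + y ^ 2 * z + z ^ 3 + y ^ 2 + y * z + z ^ 2 + 1 with hg
  have htr : g + g ^ 2 + g ^ 4 = 0 := by
    have := hF x
    clear_value g
    grind
  rw [← prod_directionResidual hc (hF y) (hF z) hg] at htr
  rcases mul_eq_zero.1 htr with h' | h'
  · rcases mul_eq_zero.1 h' with h' | h'
    · exact ⟨c, hc, h'⟩
    · exact ⟨c ^ 2, by clear_value g; grind, h'⟩
  · exact ⟨c ^ 2 + c + 1, by clear_value g; grind, h'⟩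

theorem exists_line_of_affine {K : Type*} [Field K] [CharP K 2] (hF : ∀ x : K, x ^ 8 = x) {c : K}
    (hc : c ^ 3 + c ^ 2 + 1 = 0) (v : Fin 4 → K) (hw : v 3 ≠ 0) (hv : eval v (f₁ K) = 0) :
    ∃ W : Submodule K (Fin 4 → K),
      Module.finrank K W = 2 ∧ v ∈ W ∧ ∀ w ∈ W, eval w (f₁ K) = 0 := by
  obtain ⟨x, hx⟩ : ∃ x, v 0 = v 3 * x := ⟨v 0 / v 3, by field_simp⟩
  obtain ⟨y, hy⟩ : ∃ y, v 1 = v 3 * y := ⟨v 1 / v 3, by field_simp⟩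
  obtain ⟨z, hz⟩ : ∃ z, v 2 = v 3 * z := ⟨v 2 / v 3, by field_simp⟩
  have h : x ^ 2 + x + (y ^ 3 + y ^ 2 * z + z ^ 3 + y ^ 2 + y * z + z ^ 2 + 1) = 0 := by
    rw [eval_f₁, hx, hy, hz] at hv
    refine (mul_eq_zero.1 ?_).resolve_left (pow_ne_zero 3 hw)
    linear_combination hv
  obtain ⟨d, hd, hr⟩ := exists_direction hF hc h
  obtain ⟨t, ht⟩ : ∃ t, t = y ^ 2 * (d + 1) + z ^ 2 + y + d * z := ⟨_, rfl⟩
  rw [directionResidual, ← ht] at hr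
  refine exists_line_of_pair (u := ![x, y, z, 1]) (v := ![t, d, 1, 0]) ?_ (fun a b => ?_) v
    ⟨v 3, 0, ?_⟩
  · rw [LinearIndependent.pair_iff]
    intro a b hab
    have h3 := congrFun hab 3
    have h2 := congrFun hab 2
    simp at h2 h3
    simp_all
  · simp only [eval_f₁, Pi.add_apply, Pi.smul_apply, smul_eq_mul, Matrix.cons_val]
    have h2 : (2 : K) = 0 := CharTwo.two_eq_zero
    grind
  · ext i
    fin_cases i <;> simp [hx, hy, hz]

theorem exists_line_of_infinite {K : Type*} [Field K] [CharP K 2] {c : K}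
    (hc : c ^ 3 + c ^ 2 + 1 = 0) (v : Fin 4 → K) (hw : v 3 = 0) (hv : eval v (f₁ K) = 0) :
    ∃ W : Submodule K (Fin 4 → K),
      Module.finrank K W = 2 ∧ v ∈ W ∧ ∀ w ∈ W, eval w (f₁ K) = 0 := by
  obtain ⟨d, hd, hvd⟩ : ∃ d, d ^ 3 + d ^ 2 + 1 = 0 ∧ v 1 = d * v 2 := by
    have h : (v 1 - c * v 2) * (v 1 - c ^ 2 * v 2) * (v 1 - (c ^ 2 + c + 1) * v 2) = 0 := by
      rw [eval_f₁, hw] at hv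
      grind
    rcases mul_eq_zero.1 h with h | h
    · rcases mul_eq_zero.1 h with h | h
      · exact ⟨c, hc, sub_eq_zero.1 h⟩
      · exact ⟨c ^ 2, by grind, sub_eq_zero.1 h⟩
    · exact ⟨c ^ 2 + c + 1, by grind, sub_eq_zero.1 h⟩
  refine exists_line_of_pair (u := ![1, 0, 0, 0]) (v := ![0, d, 1, 0]) ?_ (fun a b => ?_) v
    ⟨v 0, v 2, ?_⟩
  · rw [LinearIndependent.pair_iff]
    intro a b hab
    have h0 := congrFun hab 0
    have h2 := congrFun hab 2
    simp at h0 h2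
    exact ⟨h0, h2⟩
  · simp only [eval_f₁, Pi.add_apply, Pi.smul_apply, smul_eq_mul, Matrix.cons_val]
    linear_combination b ^ 3 * hd
  · ext i
    fin_cases i <;> simp [hw, hvd, mul_comm]

/-- Every `𝔽₈`-point of the cubic surface `S₁` lies on a line of the surface defined
over `𝔽₈`. -/
theorem S₁_every_F8_point_on_a_line (v : Fin 4 → GaloisField 2 3) (hv : v ≠ 0)
    (hv0 : eval v (f₁ (GaloisField 2 3)) = 0) :
    ∃ W : Submodule (GaloisField 2 3) (Fin 4 → GaloisField 2 3),
      Module.finrank (GaloisField 2 3) W = 2 ∧ v ∈ W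
        ∧ ∀ w ∈ W, eval w (f₁ (GaloisField 2 3)) = 0 := by
  have hK : Nat.card (GaloisField 2 3) = 8 := by
    rw [GaloisField.card 2 3 (by norm_num)]; norm_num
  have hF : ∀ x : GaloisField 2 3, x ^ 8 = x := by
    intro x
    have := Fintype.ofFinite (GaloisField 2 3)
    have hx := FiniteField.pow_card x
    rwa [← Nat.card_eq_fintype_card, hK] at hx
  obtain ⟨c, hc⟩ := exists_root_cubic hK hF
  by_cases hw : v 3 = 0
  · exact exists_line_of_infinite hc v hw hv0
  · exact exists_line_of_affine hF hc v hw hv0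
end

section
/- Exactly fifteen of the lines of the cubic surface S₂ are defined over 𝔽₈: there are exactly 15 two-dimensional 𝔽₈-linear subspaces W of 𝔽₈⁴ such that f₂ vanishes at every vector of W. -/
open MvPolynomial

/-- The cubic form `XY(X + Y) + Z³ + Z²W + W³` with the variables `X, Y, Z, W` indexed by
`0, 1, 2, 3`, over any commutative ring (its coefficients lie in `𝔽₂`). -/
noncomputable def f₂ (K : Type*) [CommRing K] : MvPolynomial (Fin 4) K :=
  X 0 * X 1 * (X 0 + X 1) + X 2 ^ 3 + X 2 ^ 2 * X 3 + X 3 ^ 3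

/-- The cubic form `xy(x + y) + zw(z + w)`, split over the prime field. -/
def splitCubic {K : Type*} [CommRing K] (v : Fin 4 → K) : K :=
  v 0 * v 1 * (v 0 + v 1) + v 2 * v 3 * (v 2 + v 3)

/-- Index set of the rational lines on `splitCubic`: pairs of linear factors of the two binary
cubics, and elements of `GL₂(𝔽₂)`. -/
abbrev LineIndex : Type :=
  ({a : Fin 2 → ZMod 2 // a ≠ 0} × {b : Fin 2 → ZMod 2 // b ≠ 0}) ⊕
    {M : Matrix (Fin 2) (Fin 2) (ZMod 2) // M.det ≠ 0}

/-- The coefficients of two linear equations cutting out the line with the given index. -/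
def lineEquations : LineIndex → Matrix (Fin 2) (Fin 4) (ZMod 2)
  | .inl (a, b) => !![a.1 0, a.1 1, 0, 0; 0, 0, b.1 0, b.1 1]
  | .inr M => !![M.1 0 0, M.1 0 1, 1, 0; M.1 1 0, M.1 1 1, 0, 1]

theorem card_lineIndex : Fintype.card LineIndex = 15 := by decide

theorem exists_lineEquations_mul_eq_one (i : LineIndex) :
    ∃ N : Matrix (Fin 4) (Fin 2) (ZMod 2), lineEquations i * N = 1 := by
  rcases i with ⟨⟨a, ha⟩, ⟨b, hb⟩⟩ | ⟨M, hM⟩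
  · have key : ∀ a : Fin 2 → ZMod 2, a ≠ 0 → ∃ c : Fin 2 → ZMod 2,
        a 0 * c 0 + a 1 * c 1 = 1 := by decide
    obtain ⟨c, hc⟩ := key a ha
    obtain ⟨d, hd⟩ := key b hb
    refine ⟨!![c 0, 0; c 1, 0; 0, d 0; 0, d 1], ?_⟩
    ext i j
    fin_cases i <;> fin_cases j <;>
      simp [lineEquations, Matrix.mul_apply, Fin.sum_univ_four, hc, hd]
  · refine ⟨!![0, 0; 0, 0; 1, 0; 0, 1], ?_⟩
    ext i j
    fin_cases i <;> fin_cases j <;>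
      simp [lineEquations, Matrix.mul_apply, Fin.sum_univ_four]

set_option synthInstance.maxSize 1000 in
theorem lineEquations_injective_of_mulVec (i j : LineIndex)
    (h : ∀ v, (lineEquations i).mulVec v = 0 ↔ (lineEquations j).mulVec v = 0) : i = j := by
  revert i j
  decide +kernel

section CharTwo

variable {K : Type*} [Field K] [CharP K 2]

variable (K) in
/-- The line over `K` with the given index. -/
noncomputable def rationalLine (i : LineIndex) : Submodule K (Fin 4 → K) :=
  LinearMap.ker ((lineEquations i).map (ZMod.castHom dvd_rfl K)).mulVecLin

theorem mem_rationalLine_inl (a b) (v : Fin 4 → K) :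
    v ∈ rationalLine K (.inl (a, b)) ↔
      ((a.1 0).cast * v 0 + (a.1 1).cast * v 1 = 0 ∧
        (b.1 0).cast * v 2 + (b.1 1).cast * v 3 = 0) := by
  simp [rationalLine, lineEquations, funext_iff, Fin.forall_fin_two, Matrix.mulVec, dotProduct,
    Fin.sum_univ_four]

theorem mem_rationalLine_inr (M) (v : Fin 4 → K) :
    v ∈ rationalLine K (.inr M) ↔
      ((M.1 0 0).cast * v 0 + (M.1 0 1).cast * v 1 + v 2 = 0 ∧
        (M.1 1 0).cast * v 0 + (M.1 1 1).cast * v 1 + v 3 = 0) := by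
  simp [rationalLine, lineEquations, funext_iff, Fin.forall_fin_two, Matrix.mulVec, dotProduct,
    Fin.sum_univ_four]

theorem finrank_rationalLine (i : LineIndex) : Module.finrank K (rationalLine K i) = 2 := by
  obtain ⟨N, hN⟩ := exists_lineEquations_mul_eq_one i
  have hsurj : Function.Surjective
      ((lineEquations i).map (ZMod.castHom dvd_rfl K)).mulVecLin := by
    intro w
    refine ⟨(N.map (ZMod.castHom dvd_rfl K)).mulVec w, ?_⟩
    rw [Matrix.mulVecLin_apply, Matrix.mulVec_mulVec, ← Matrix.map_mul, hN]
    simp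
  have h := LinearMap.finrank_range_add_finrank_ker
    ((lineEquations i).map (ZMod.castHom dvd_rfl K)).mulVecLin
  rw [LinearMap.range_eq_top.mpr hsurj, finrank_top] at h
  simp only [Module.finrank_fin_fun] at h
  rw [rationalLine]
  lia

theorem rationalLine_injective : Function.Injective (rationalLine K) := by
  intro i j hij
  refine lineEquations_injective_of_mulVec i j fun v => ?_
  have key : ∀ k, (ZMod.castHom dvd_rfl K) ∘ v ∈ rationalLine K k ↔
      (lineEquations k).mulVec v = 0 := by
    intro k
    rw [rationalLine, LinearMap.mem_ker, Matrix.mulVecLin_apply, funext_iff, funext_iff]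
    refine forall_congr' fun r => ?_
    rw [← RingHom.map_mulVec]
    simp only [Pi.zero_apply]
    exact map_eq_zero _
  rw [← key, ← key, hij]

theorem binaryCubic_eq_zero_iff (x y : K) :
    x * y * (x + y) = 0 ↔
      ∃ a : {a : Fin 2 → ZMod 2 // a ≠ 0}, (a.1 0).cast * x + (a.1 1).cast * y = 0 := by
  constructor
  · intro h
    rcases mul_eq_zero.mp h with h | h
    · rcases mul_eq_zero.mp h with h | h
      · exact ⟨⟨![1, 0], by decide⟩, by simp [h]⟩
      · exact ⟨⟨![0, 1], by decide⟩, by simp [h]⟩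
    · exact ⟨⟨![1, 1], by decide⟩, by simpa using h⟩
  · rintro ⟨⟨a, ha⟩, h⟩
    have key : ∀ a : Fin 2 → ZMod 2, a ≠ 0 →
        (a 0 = 1 ∧ a 1 = 0) ∨ (a 0 = 0 ∧ a 1 = 1) ∨ (a 0 = 1 ∧ a 1 = 1) := by decide
    rcases key a ha with ⟨h0, h1⟩ | ⟨h0, h1⟩ | ⟨h0, h1⟩ <;> simp [h0, h1] at h <;> simp [h]

theorem splitCubic_eq_zero_of_mem_rationalLine (i : LineIndex) {v : Fin 4 → K}
    (hv : v ∈ rationalLine K i) : splitCubic v = 0 := by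
  have h2 : (2 : K) = 0 := CharTwo.two_eq_zero
  rcases i with ⟨a, b⟩ | ⟨M, hM⟩
  · rw [mem_rationalLine_inl] at hv
    rw [splitCubic, (binaryCubic_eq_zero_iff _ _).mpr ⟨a, hv.1⟩,
      (binaryCubic_eq_zero_iff _ _).mpr ⟨b, hv.2⟩, add_zero]
  · rw [mem_rationalLine_inr] at hv
    obtain ⟨hz, hw⟩ := hv
    have key : ∀ t : ZMod 2, t = 0 ∨ t = 1 := by decide
    rw [Matrix.det_fin_two] at hM
    rw [splitCubic]
    rcases key (M 0 0) with h | h <;> rcases key (M 0 1) with h' | h' <;>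
      rcases key (M 1 0) with k | k <;> rcases key (M 1 1) with k' | k' <;>
      simp [h, h', k, k'] at hM hz hw <;> grind

theorem exists_matrix_of_binaryCubic_comp (hcube : ∀ x : K, x ^ 3 = 1 → x = 1) {a b c d : K}
    (hab : a * b * (a + b) = 0) (hcd : c * d * (c + d) = 0)
    (h₁ : a * b * (c + d) + (a * d + b * c) * (a + b) = 1)
    (h₂ : c * d * (a + b) + (a * d + b * c) * (c + d) = 1) :
    ∃ M : {M : Matrix (Fin 2) (Fin 2) (ZMod 2) // M.det ≠ 0},
      (M.1 0 0).cast = a ∧ (M.1 0 1).cast = c ∧ (M.1 1 0).cast = b ∧ (M.1 1 1).cast = d := by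
  have h2 : (2 : K) = 0 := CharTwo.two_eq_zero
  have hmem : (a = 0 ∨ a = 1) ∧ (b = 0 ∨ b = 1) ∧ (c = 0 ∨ c = 1) ∧ (d = 0 ∨ d = 1) := by
    have := hcube a
    have := hcube b
    have := hcube c
    have := hcube d
    have hab : a = 0 ∨ b = 0 ∨ a = b := by grind
    have hcd : c = 0 ∨ d = 0 ∨ c = d := by grind
    rcases hab with rfl | rfl | rfl <;> rcases hcd with rfl | rfl | rfl <;> grind
  have key : ∀ t : K, t = 0 ∨ t = 1 → ∃ s : ZMod 2, s.cast = t := by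
    rintro t (rfl | rfl)
    · exact ⟨0, by simp⟩
    · exact ⟨1, by simp⟩
  obtain ⟨a, rfl⟩ := key a hmem.1
  obtain ⟨b, rfl⟩ := key b hmem.2.1
  obtain ⟨c, rfl⟩ := key c hmem.2.2.1
  obtain ⟨d, rfl⟩ := key d hmem.2.2.2
  refine ⟨⟨!![a, c; b, d], fun hdet => ?_⟩, by simp⟩
  have hdet' : ((a.cast : K)) * d.cast - c.cast * b.cast = 0 := by
    have := congrArg (ZMod.castHom dvd_rfl K) hdet
    simpa [Matrix.det_fin_two] using this
  clear hcube hmem key hdet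
  grind

theorem exists_le_rationalLine (hcube : ∀ x : K, x ^ 3 = 1 → x = 1) {s : K} (hs₀ : s ≠ 0)
    (hs₁ : s ≠ 1) {W : Submodule K (Fin 4 → K)} (hW : Module.finrank K W = 2)
    (h : ∀ v ∈ W, splitCubic v = 0) : ∃ i, W ≤ rationalLine K i := by
  have h2 : (2 : K) = 0 := CharTwo.two_eq_zero
  let p : W →ₗ[K] (Fin 2 → K) :=
    (LinearMap.funLeft K K (Fin.castAdd 2)) ∘ₗ W.subtype
  have hp0 : ∀ w : W, p w 0 = w.1 0 := fun w => rfl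
  have hp1 : ∀ w : W, p w 1 = w.1 1 := fun w => rfl
  by_cases hinj : Function.Injective p
  · have hsurj : Function.Surjective p :=
      (LinearMap.injective_iff_surjective_of_finrank_eq_finrank (by simp [hW])).mp hinj
    obtain ⟨u, hu⟩ := hsurj ![1, 0]
    obtain ⟨v, hv⟩ := hsurj ![0, 1]
    have hu0 : u.1 0 = 1 := by simp [← hp0, hu]
    have hu1 : u.1 1 = 0 := by simp [← hp1, hu]
    have hv0 : v.1 0 = 0 := by simp [← hp0, hv]
    have hv1 : v.1 1 = 1 := by simp [← hp1, hv]
    have hQ : ∀ t : K, splitCubic (u.1 + t • v.1) = 0 := fun t =>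
      h _ (W.add_mem u.2 (W.smul_mem t v.2))
    have hQu := h _ u.2
    have hQv := h _ v.2
    have hQ1 := hQ 1
    have hQs := hQ s
    simp only [splitCubic, Pi.add_apply, Pi.smul_apply, smul_eq_mul, hu0, hu1, hv0, hv1]
      at hQu hQv hQ1 hQs
    have hs : s * (s - 1) ≠ 0 := mul_ne_zero hs₀ (sub_ne_zero.mpr hs₁)
    obtain ⟨M, ha, hc, hb, hd⟩ := exists_matrix_of_binaryCubic_comp hcube
      (a := u.1 2) (b := u.1 3) (c := v.1 2) (d := v.1 3) (by grind) (by grind)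
      (by
        apply mul_left_cancel₀ hs
        grind)
      (by
        apply mul_left_cancel₀ hs
        grind)
    refine ⟨.inr M, fun w hw => ?_⟩
    have hw' : (⟨w, hw⟩ : W) = w 0 • u + w 1 • v := by
      apply hinj
      rw [map_add, map_smul, map_smul, hu, hv]
      ext k
      fin_cases k <;> simp [hp0, hp1]
    have hw2 := congrArg (fun x : W => x.1 2) hw'
    have hw3 := congrArg (fun x : W => x.1 3) hw'
    simp only [Submodule.coe_add, Submodule.coe_smul, Pi.add_apply, Pi.smul_apply, smul_eq_mul]
      at hw2 hw3
    rw [mem_rationalLine_inr, ha, hb, hc, hd, hw2, hw3]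
    constructor <;> grind
  · have hker : LinearMap.ker p ≠ ⊥ := fun hk => hinj (LinearMap.ker_eq_bot.mp hk)
    obtain ⟨u, hup, hu⟩ := Submodule.exists_mem_ne_zero_of_ne_bot hker
    have hu0 : u.1 0 = 0 := by rw [← hp0, LinearMap.mem_ker.mp hup]; rfl
    have hu1 : u.1 1 = 0 := by rw [← hp1, LinearMap.mem_ker.mp hup]; rfl
    have hu23 : u.1 2 ≠ 0 ∨ u.1 3 ≠ 0 := by
      by_contra! hcon
      apply hu
      ext k
      fin_cases k <;> simp [hu0, hu1, hcon]
    have hQu := h _ u.2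
    simp only [splitCubic, hu0, hu1, mul_zero, zero_add] at hQu
    obtain ⟨b, hb⟩ := (binaryCubic_eq_zero_iff _ _).mp hQu
    have hrange : Module.finrank K (LinearMap.range p) ≤ 1 := by
      have h1 := LinearMap.finrank_range_add_finrank_ker p
      have h3 : Module.finrank K (LinearMap.ker p) ≠ 0 := fun h0 =>
        hker (Submodule.finrank_eq_zero.mp h0)
      lia
    obtain ⟨⟨_, w₁, rfl⟩, hw₁⟩ := finrank_le_one_iff.mp hrange
    have hall : ∀ w ∈ W, (b.1 0).cast * w 2 + (b.1 1).cast * w 3 = 0 := by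
      intro w hw
      have hQ : ∀ t : K, splitCubic (w + t • u.1) = 0 := fun t =>
        h _ (W.add_mem hw (W.smul_mem t u.2))
      have hbit : ∀ b : Fin 2 → ZMod 2, b ≠ 0 →
          (b 0 = 1 ∧ b 1 = 0) ∨ (b 0 = 0 ∧ b 1 = 1) ∨ (b 0 = 1 ∧ b 1 = 1) := by decide
      obtain ⟨c, hc, hbc⟩ : ∃ c : K, c ≠ 0 ∧
          ∀ t, (b.1 0).cast * w 2 + (b.1 1).cast * w 3 ≠ 0 →
            t * c * (t * c + ((b.1 0).cast * w 2 + (b.1 1).cast * w 3)) = 0 := by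
        have hQ0 := hQ 0
        simp only [splitCubic, Pi.add_apply, Pi.smul_apply, smul_eq_mul, hu0, hu1] at hQ hQ0
        rcases hbit b.1 b.2 with ⟨h0, h1⟩ | ⟨h0, h1⟩ | ⟨h0, h1⟩ <;>
          simp only [h0, h1, ZMod.cast_one', ZMod.cast_zero, one_mul, zero_mul, add_zero, zero_add]
            at hb ⊢
        · refine ⟨u.1 3, by grind, fun t ht => mul_left_cancel₀ ht ?_⟩
          have := hQ t
          grind
        · refine ⟨u.1 2, by grind, fun t ht => mul_left_cancel₀ ht ?_⟩
          have := hQ t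
          grind
        · refine ⟨u.1 2, by grind, fun t ht => mul_left_cancel₀ ht ?_⟩
          have := hQ t
          grind
      by_contra he
      have h₁ := hbc c⁻¹ he
      have hs := hbc (s * c⁻¹) he
      grind
    have hQw := h _ w₁.2
    rw [splitCubic, (binaryCubic_eq_zero_iff (w₁.1 2) _).mpr ⟨b, hall _ w₁.2⟩, add_zero] at hQw
    obtain ⟨a, ha⟩ := (binaryCubic_eq_zero_iff _ _).mp hQw
    refine ⟨.inl (a, b), fun w hw => (mem_rationalLine_inl _ _ _).mpr ⟨?_, hall w hw⟩⟩
    obtain ⟨c, hc⟩ := hw₁ ⟨_, ⟨w, hw⟩, rfl⟩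
    have hc0 : c * w₁.1 0 = w 0 := congrArg (fun x => x.1 0) hc
    have hc1 : c * w₁.1 1 = w 1 := congrArg (fun x => x.1 1) hc
    rw [← hc0, ← hc1]
    linear_combination c * ha

theorem setOf_splitCubic_eq_range_rationalLine (hcube : ∀ x : K, x ^ 3 = 1 → x = 1) {s : K}
    (hs₀ : s ≠ 0) (hs₁ : s ≠ 1) :
    {W : Submodule K (Fin 4 → K) | Module.finrank K W = 2 ∧ ∀ v ∈ W, splitCubic v = 0} =
      Set.range (rationalLine K) := by
  ext W
  constructor
  · rintro ⟨hW, h⟩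
    obtain ⟨i, hi⟩ := exists_le_rationalLine hcube hs₀ hs₁ hW h
    exact ⟨i, (Submodule.eq_of_le_of_finrank_eq hi (by rw [hW, finrank_rationalLine])).symm⟩
  · rintro ⟨i, rfl⟩
    exact ⟨finrank_rationalLine i, fun v => splitCubic_eq_zero_of_mem_rationalLine i⟩

/-- The change of coordinates attached to a root `α` of `X³ + X² + 1`, carrying `f₂` to
`splitCubic`. -/
def splittingEquiv (α : K) (hα : α ^ 3 + α ^ 2 + 1 = 0) : (Fin 4 → K) ≃ₗ[K] (Fin 4 → K) where
  toFun v := ![v 0, v 1, (1 + α) * (v 2 + α * v 3), (1 + α ^ 2) * (v 2 + α ^ 2 * v 3)]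
  invFun v := ![v 0, v 1, (1 + α ^ 2) * α ^ 2 * v 2 + (1 + α) * α * v 3,
    (1 + α ^ 2) * v 2 + (1 + α) * v 3]
  map_add' v w := by
    ext k
    fin_cases k <;> simp <;> ring
  map_smul' c v := by
    ext k
    fin_cases k <;> simp <;> ring
  left_inv v := by
    have h2 : (2 : K) = 0 := CharTwo.two_eq_zero
    ext k
    fin_cases k <;> simp <;> grind
  right_inv v := by
    have h2 : (2 : K) = 0 := CharTwo.two_eq_zero
    ext k
    fin_cases k <;> simp <;> grind

theorem splitCubic_splittingEquiv (α : K) (hα : α ^ 3 + α ^ 2 + 1 = 0) (v : Fin 4 → K) :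
    splitCubic (splittingEquiv α hα v) = eval v (f₂ K) := by
  have h2 : (2 : K) = 0 := CharTwo.two_eq_zero
  simp [splitCubic, splittingEquiv, f₂]
  grind

theorem ncard_lines_f₂ (hcube : ∀ x : K, x ^ 3 = 1 → x = 1) {α : K}
    (hα : α ^ 3 + α ^ 2 + 1 = 0) :
    {W : Submodule K (Fin 4 → K) |
      Module.finrank K W = 2 ∧ ∀ v ∈ W, eval v (f₂ K) = 0}.ncard = 15 := by
  have hα₀ : α ≠ 0 := by
    rintro rfl
    simp at hα
  have hα₁ : α ≠ 1 := by
    rintro rfl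
    have h2 : (2 : K) = 0 := CharTwo.two_eq_zero
    have h3 : (1 : K) = 0 := by linear_combination hα - h2
    exact one_ne_zero h3
  obtain ⟨e, he⟩ : ∃ e : (Fin 4 → K) ≃ₗ[K] (Fin 4 → K),
      ∀ v, splitCubic (e v) = eval v (f₂ K) :=
    ⟨splittingEquiv α hα, splitCubic_splittingEquiv α hα⟩
  have hset : {W : Submodule K (Fin 4 → K) |
      Module.finrank K W = 2 ∧ ∀ v ∈ W, eval v (f₂ K) = 0} =
      (Submodule.orderIsoMapComap e) ⁻¹' {W : Submodule K (Fin 4 → K) |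
        Module.finrank K W = 2 ∧ ∀ v ∈ W, splitCubic v = 0} := by
    ext W
    simp only [Set.mem_ofPred_eq, Set.mem_preimage, Submodule.orderIsoMapComap_apply]
    refine and_congr (by rw [(e.submoduleMap W).finrank_eq]) ?_
    exact ⟨by rintro h _ ⟨v, hv, rfl⟩; exact (he v).trans (h v hv),
      fun h v hv => (he v).symm.trans (h _ ⟨v, hv, rfl⟩)⟩
  rw [hset, Set.ncard_preimage_of_injective_subset_range (OrderIso.injective _)
    (by simp [(OrderIso.surjective _).range_eq]),
    setOf_splitCubic_eq_range_rationalLine hcube hα₀ hα₁, ← Set.image_univ,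
    Set.ncard_image_of_injective _ rationalLine_injective, Set.ncard_univ,
    Nat.card_eq_fintype_card, card_lineIndex]

theorem exists_root_of_card_eq_eight [Fintype K] (hK : Fintype.card K = 8) :
    ∃ α : K, α ^ 3 + α ^ 2 + 1 = 0 := by
  classical
  have h2 : (2 : K) = 0 := CharTwo.two_eq_zero
  obtain ⟨x, hx⟩ : ∃ x : K, x ∉ ({0, 1} : Finset K) := by
    by_contra! hcon
    have h := Finset.card_le_card (s := Finset.univ) fun x _ => hcon x
    have h' := Finset.card_le_two (a := (0 : K)) (b := 1)
    rw [Finset.card_univ, hK] at h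
    lia
  simp only [Finset.mem_insert, Finset.mem_singleton, not_or] at hx
  obtain ⟨hx0, hx1⟩ := hx
  have hx8 : x ^ 8 = x := hK ▸ FiniteField.pow_card x
  have hprod : (x * (x - 1)) * ((x ^ 3 + x + 1) * (x ^ 3 + x ^ 2 + 1)) = 0 := by grind
  rcases mul_eq_zero.mp ((mul_eq_zero.mp hprod).resolve_left
    (mul_ne_zero hx0 (sub_ne_zero.mpr hx1))) with h | h
  · refine ⟨x⁻¹, ?_⟩
    field_simp
    linear_combination h
  · exact ⟨x, h⟩

theorem eq_one_of_pow_three_eq_one [Fintype K] (hK : Fintype.card K = 8) (x : K)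
    (hx : x ^ 3 = 1) : x = 1 := by
  have hx8 : x ^ 8 = x := hK ▸ FiniteField.pow_card x
  grind

end CharTwo

/-- Exactly fifteen of the lines of the cubic surface `S₂` are defined over `𝔽₈`: there are
exactly `15` two-dimensional `𝔽₈`-linear subspaces of `𝔽₈⁴` on which `f₂` vanishes
identically. -/
theorem S₂_card_lines_over_F8 :
    {W : Submodule (GaloisField 2 3) (Fin 4 → GaloisField 2 3) |
        Module.finrank (GaloisField 2 3) W = 2
          ∧ ∀ v ∈ W, eval v (f₂ (GaloisField 2 3)) = 0}.ncard = 15 := by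
  have := Fintype.ofFinite (GaloisField 2 3)
  have hK : Fintype.card (GaloisField 2 3) = 8 := by
    rw [← Nat.card_eq_fintype_card, GaloisField.card 2 3 (by simp)]
    norm_num
  obtain ⟨α, hα⟩ := exists_root_of_card_eq_eight hK
  exact ncard_lines_f₂ (eq_one_of_pow_three_eq_one hK) hα
end

section
/- The cubic surface S₂ splits over 𝔽₆₄: there are exactly 27 two-dimensional 𝔽₆₄-linear subspaces W of 𝔽₆₄⁴ such that f₂ vanishes at every vector of W, i.e. all 27 lines of the surface are defined over the field with 64 elements. -/
open MvPolynomial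

/-- The line `v₀ = ζ vⱼ, vₖ = η vₗ` of the Fermat cubic, where `j = i + 1` and `k < l` are the two
remaining nonzero indices. -/
def fermatLine {K : Type*} [Field K] (x : Fin 3 × K × K) : Submodule K (Fin 4 → K) where
  carrier := {v | v 0 = x.2.1 * v (![1, 2, 3] x.1) ∧ v (![2, 1, 1] x.1) = x.2.2 * v (![3, 3, 2] x.1)}
  zero_mem' := by simp
  add_mem' := by
    rintro v w ⟨h1, h2⟩ ⟨h3, h4⟩
    constructor
    · simp only [Pi.add_apply, h1, h3]; ring
    · simp only [Pi.add_apply, h2, h4]; ring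
  smul_mem' := by
    rintro c v ⟨h1, h2⟩
    constructor
    · simp only [Pi.smul_apply, smul_eq_mul, h1]; ring
    · simp only [Pi.smul_apply, smul_eq_mul, h2]; ring

theorem mem_fermatLine {K : Type*} [Field K] {x : Fin 3 × K × K} {v : Fin 4 → K} :
    v ∈ fermatLine x ↔
      v 0 = x.2.1 * v (![1, 2, 3] x.1) ∧ v (![2, 1, 1] x.1) = x.2.2 * v (![3, 3, 2] x.1) :=
  Iff.rfl

theorem finrank_fermatLine {K : Type*} [Field K] (x : Fin 3 × K × K) :
    Module.finrank K (fermatLine x) = 2 := by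
  obtain ⟨i, ζ, η⟩ := x
  let φ : fermatLine (i, ζ, η) →ₗ[K] (Fin 2 → K) :=
    LinearMap.pi ![(LinearMap.proj (![1, 2, 3] i)).comp (Submodule.subtype _),
      (LinearMap.proj (![3, 3, 2] i)).comp (Submodule.subtype _)]
  have hφ : Function.Bijective φ := by
    constructor
    · rw [injective_iff_map_eq_zero]
      rintro ⟨v, hv⟩ h
      have h0 : v (![1, 2, 3] i) = 0 := congrFun h 0
      have h1 : v (![3, 3, 2] i) = 0 := congrFun h 1
      rw [mem_fermatLine] at hv
      ext j
      fin_cases i <;> fin_cases j <;> simp_all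
    · intro w
      refine ⟨⟨![![ζ * w 0, w 0, η * w 1, w 1], ![ζ * w 0, η * w 1, w 0, w 1],
        ![ζ * w 0, η * w 1, w 1, w 0]] i, ?_⟩, ?_⟩
      · rw [mem_fermatLine]
        fin_cases i <;> simp
      · ext j
        fin_cases i <;> fin_cases j <;> simp [φ]
  rw [(LinearEquiv.ofBijective φ hφ).finrank_eq]
  simp

theorem fermatLine_injOn {K : Type*} [Field K] :
    Set.InjOn (fermatLine (K := K)) (Set.univ ×ˢ {x | x ^ 3 = 1} ×ˢ {x | x ^ 3 = 1}) := by
  rintro ⟨i, ζ, η⟩ ⟨-, hζ, hη⟩ ⟨i', ζ', η'⟩ ⟨-, hζ', hη'⟩ h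
  simp only [Set.mem_ofPred_eq] at hζ hη hζ' hη'
  have hζ0 : ζ ≠ 0 := by rintro rfl; simp at hζ
  have hp : ∀ a b : K, ![![ζ * a, a, η * b, b], ![ζ * a, η * b, a, b],
      ![ζ * a, η * b, b, a]] i ∈ fermatLine (i', ζ', η') := by
    intro a b
    rw [← h, mem_fermatLine]
    fin_cases i <;> simp
  have h1 := mem_fermatLine.1 (hp 1 0)
  have h2 := mem_fermatLine.1 (hp 0 1)
  fin_cases i <;> fin_cases i' <;> simp_all

section CharTwo

variable {K : Type*} [Field K] [CharP K 2]

/-- Polarization of the Fermat cubic along a subspace in characteristic two. -/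
theorem sum_sq_mul_eq_zero {ω : K} (hω : ω ^ 2 + ω + 1 = 0) {W : Submodule K (Fin 4 → K)}
    (hW : ∀ v ∈ W, v 0 ^ 3 + v 1 ^ 3 + v 2 ^ 3 + v 3 ^ 3 = 0) {p q : Fin 4 → K}
    (hp : p ∈ W) (hq : q ∈ W) :
    p 0 ^ 2 * q 0 + p 1 ^ 2 * q 1 + p 2 ^ 2 * q 2 + p 3 ^ 2 * q 3 = 0 := by
  have h2 : (2 : K) = 0 := CharTwo.two_eq_zero
  have e1 := hW _ hp
  have e2 := hW _ hq
  have e3 := hW _ (W.add_mem hp hq)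
  have e4 := hW _ (W.add_mem hp (W.smul_mem ω hq))
  simp only [Pi.add_apply, Pi.smul_apply, smul_eq_mul] at e3 e4
  have hω3 : ω ^ 3 = 1 := by linear_combination (ω - 1) * hω
  generalize hA : p 0 ^ 2 * q 0 + p 1 ^ 2 * q 1 + p 2 ^ 2 * q 2 + p 3 ^ 2 * q 3 = A
  generalize hB : p 0 * q 0 ^ 2 + p 1 * q 1 ^ 2 + p 2 * q 2 ^ 2 + p 3 * q 3 ^ 2 = B
  have f1 : A + B = 0 := by
    linear_combination e3 - e1 - e2 - hA - hB - h2 *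
      (p 0 ^ 2 * q 0 + p 1 ^ 2 * q 1 + p 2 ^ 2 * q 2 + p 3 ^ 2 * q 3 +
      (p 0 * q 0 ^ 2 + p 1 * q 1 ^ 2 + p 2 * q 2 ^ 2 + p 3 * q 3 ^ 2))
  have f2 : ω * A + ω ^ 2 * B = 0 := by
    linear_combination e4 - e1 - ω ^ 3 * e2 - ω * hA - ω ^ 2 * hB - h2 *
      (ω * (p 0 ^ 2 * q 0 + p 1 ^ 2 * q 1 + p 2 ^ 2 * q 2 + p 3 ^ 2 * q 3) +
      ω ^ 2 * (p 0 * q 0 ^ 2 + p 1 * q 1 ^ 2 + p 2 * q 2 ^ 2 + p 3 * q 3 ^ 2))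
  linear_combination ω ^ 2 * f1 - f2 + A * (-hω + h2 * (1 + ω))

/-- A line on which the first two coordinates are independent. -/
theorem exists_fermatLine_eq_of_dual {ω : K} (hω : ω ^ 2 + ω + 1 = 0)
    {W : Submodule K (Fin 4 → K)} (hr : Module.finrank K W = 2)
    (hW : ∀ v ∈ W, v 0 ^ 3 + v 1 ^ 3 + v 2 ^ 3 + v 3 ^ 3 = 0)
    {p q : Fin 4 → K} (hp : p ∈ W) (hq : q ∈ W)
    (p0 : p 0 = 1) (p1 : p 1 = 0) (q0 : q 0 = 0) (q1 : q 1 = 1) :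
    ∃ i : Fin 3, ∃ ζ η : K, ζ ^ 3 = 1 ∧ η ^ 3 = 1 ∧ fermatLine (i, ζ, η) = W := by
  have h2 : (2 : K) = 0 := CharTwo.two_eq_zero
  have e1 := hW p hp
  have e2 := hW q hq
  have e3 := sum_sq_mul_eq_zero hω hW hp hq
  have e4 := sum_sq_mul_eq_zero hω hW hq hp
  simp only [p0, p1, q0, q1] at e1 e2 e3 e4
  have key : (p 2 = 0 ∧ q 3 = 0) ∨ (p 3 = 0 ∧ q 2 = 0) := by
    grind
  have hle : ∀ L : Submodule K (Fin 4 → K), Module.finrank K L = 2 →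
      (∀ v ∈ L, v = v 0 • p + v 1 • q) → L = W := by
    intro L hL h
    refine Submodule.eq_of_le_of_finrank_eq (fun v hv => ?_) (hL.trans hr.symm)
    rw [h v hv]
    exact W.add_mem (W.smul_mem _ hp) (W.smul_mem _ hq)
  rcases key with ⟨h, h'⟩ | ⟨h, h'⟩
  · refine ⟨2, p 3 ^ 2, q 2 ^ 2, by grind, by grind, hle _ (finrank_fermatLine _) ?_⟩
    intro v hv
    obtain ⟨a, b⟩ := mem_fermatLine.1 hv
    simp at a b
    ext j
    fin_cases j <;> simp <;> grind
  · refine ⟨1, p 2 ^ 2, q 3 ^ 2, by grind, by grind, hle _ (finrank_fermatLine _) ?_⟩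
    intro v hv
    obtain ⟨a, b⟩ := mem_fermatLine.1 hv
    simp at a b
    ext j
    fin_cases j <;> simp <;> grind

/-- A line containing a point at which the first two coordinates vanish. -/
theorem exists_fermatLine_eq_of_vanish {ω : K} (hω : ω ^ 2 + ω + 1 = 0)
    {W : Submodule K (Fin 4 → K)} (hr : Module.finrank K W = 2)
    (hW : ∀ v ∈ W, v 0 ^ 3 + v 1 ^ 3 + v 2 ^ 3 + v 3 ^ 3 = 0)
    {p : Fin 4 → K} (hp : p ∈ W) (hne : p ≠ 0) (p0 : p 0 = 0) (p1 : p 1 = 0) :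
    ∃ i : Fin 3, ∃ ζ η : K, ζ ^ 3 = 1 ∧ η ^ 3 = 1 ∧ fermatLine (i, ζ, η) = W := by
  have h2 : (2 : K) = 0 := CharTwo.two_eq_zero
  have e1 := hW p hp
  have p3 : p 3 ≠ 0 := by
    intro h
    refine hne (funext fun j => ?_)
    fin_cases j <;> simp <;> grind
  have hη : (p 2 / p 3) ^ 3 = 1 := by
    field_simp
    grind
  have hv2 : ∀ v ∈ W, v 2 = p 2 / p 3 * v 3 := by
    intro v hv
    have := sum_sq_mul_eq_zero hω hW hp (W.sub_mem hv (W.smul_mem (v 3 / p 3) hp))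
    simp [p0, p1] at this
    field_simp
    grind
  obtain ⟨q, hq, hq0⟩ : ∃ q ∈ W, ¬ (q 0 = 0 ∧ q 1 = 0) := by
    by_contra! h
    have hle : W ≤ Submodule.span K {p} := by
      intro v hv
      rw [Submodule.mem_span_singleton]
      refine ⟨v 3 / p 3, ?_⟩
      have := h v hv
      have := hv2 v hv
      ext j
      fin_cases j <;> simp <;> grind
    have := (Submodule.finrank_mono hle).trans (finrank_span_le_card _)
    simp [hr] at this
  have hpq : ∀ v ∈ W, q 0 ^ 2 * v 0 + q 1 ^ 2 * v 1 = 0 := by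
    intro v hv
    have a := sum_sq_mul_eq_zero hω hW hq hv
    rw [hv2 q hq, hv2 v hv] at a
    linear_combination a - q 3 ^ 2 * v 3 * (hη + h2)
  have e2 := hpq q hq
  have q0 : q 0 ≠ 0 := by grind
  refine ⟨0, (q 1 / q 0) ^ 2, p 2 / p 3, ?_, hη, (Submodule.eq_of_le_of_finrank_eq ?_
    (hr.trans (finrank_fermatLine _).symm)).symm⟩
  · field_simp
    linear_combination (q 1 ^ 3 - q 0 ^ 3) * e2
  · intro v hv
    refine mem_fermatLine.2 ⟨?_, hv2 v hv⟩
    have := hpq v hv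
    simp only [Matrix.cons_val_zero]
    field_simp
    linear_combination this - h2 * (q 1 ^ 2 * v 1)

theorem exists_fermatLine_eq {ω : K} (hω : ω ^ 2 + ω + 1 = 0) {W : Submodule K (Fin 4 → K)}
    (hr : Module.finrank K W = 2) (hW : ∀ v ∈ W, v 0 ^ 3 + v 1 ^ 3 + v 2 ^ 3 + v 3 ^ 3 = 0) :
    ∃ i : Fin 3, ∃ ζ η : K, ζ ^ 3 = 1 ∧ η ^ 3 = 1 ∧ fermatLine (i, ζ, η) = W := by
  let φ : W →ₗ[K] (Fin 2 → K) :=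
    LinearMap.pi ![(LinearMap.proj 0).comp W.subtype, (LinearMap.proj 1).comp W.subtype]
  by_cases hφ : Function.Injective φ
  · have hs : Function.Surjective φ :=
      (LinearMap.injective_iff_surjective_of_finrank_eq_finrank (by simp [hr])).1 hφ
    obtain ⟨⟨p, hp⟩, hp'⟩ := hs ![1, 0]
    obtain ⟨⟨q, hq⟩, hq'⟩ := hs ![0, 1]
    exact exists_fermatLine_eq_of_dual hω hr hW hp hq (congrFun hp' 0) (congrFun hp' 1)
      (congrFun hq' 0) (congrFun hq' 1)
  · rw [injective_iff_map_eq_zero] at hφ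
    push Not at hφ
    obtain ⟨⟨p, hp⟩, hp', hne⟩ := hφ
    exact exists_fermatLine_eq_of_vanish hω hr hW hp (fun h => hne (Subtype.ext h))
      (congrFun hp' 0) (congrFun hp' 1)

theorem ncard_fermat_lines {ω : K} (hω : ω ^ 2 + ω + 1 = 0) :
    {W : Submodule K (Fin 4 → K) | Module.finrank K W = 2 ∧
      ∀ v ∈ W, v 0 ^ 3 + v 1 ^ 3 + v 2 ^ 3 + v 3 ^ 3 = 0}.ncard = 27 := by
  have h2 : (2 : K) = 0 := CharTwo.two_eq_zero
  have hμ : {x : K | x ^ 3 = 1} = {1, ω, ω ^ 2} := by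
    ext x
    simp only [Set.mem_ofPred_eq, Set.mem_insert_iff, Set.mem_singleton_iff]
    constructor
    · intro h
      have : (x - 1) * ((x - ω) * (x - ω ^ 2)) = 0 := by grind
      simpa [sub_eq_zero] using this
    · rintro (rfl | rfl | rfl) <;> grind
  have hμc : {x : K | x ^ 3 = 1}.ncard = 3 := by
    rw [hμ, Set.ncard_eq_three]
    exact ⟨1, ω, ω ^ 2, by grind, by grind, by grind, rfl⟩
  have himg : {W : Submodule K (Fin 4 → K) | Module.finrank K W = 2 ∧
      ∀ v ∈ W, v 0 ^ 3 + v 1 ^ 3 + v 2 ^ 3 + v 3 ^ 3 = 0} =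
      fermatLine '' (Set.univ ×ˢ {x | x ^ 3 = 1} ×ˢ {x | x ^ 3 = 1}) := by
    ext W
    constructor
    · rintro ⟨hr, hW⟩
      obtain ⟨i, ζ, η, hζ, hη, h⟩ := exists_fermatLine_eq hω hr hW
      exact ⟨(i, ζ, η), ⟨trivial, hζ, hη⟩, h⟩
    · rintro ⟨⟨i, ζ, η⟩, ⟨-, hζ, hη⟩, rfl⟩
      refine ⟨finrank_fermatLine _, fun v hv => ?_⟩
      obtain ⟨a, b⟩ := mem_fermatLine.1 hv
      simp only [Set.mem_ofPred_eq] at hζ hη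
      fin_cases i <;> simp at a b <;> rw [a, b] <;> grind
  rw [himg, fermatLine_injOn.ncard_image, Set.ncard_prod, Set.ncard_prod, hμc, Set.ncard_univ]
  simp

/-- The change of coordinates, over a field with a primitive ninth root of unity `θ`, that turns
the Fermat cubic into `f₂`. -/
def fermatEquiv {θ : K} (hθ : θ ^ 6 + θ ^ 3 + 1 = 0) : (Fin 4 → K) ≃ₗ[K] (Fin 4 → K) where
  toFun v := ![θ ^ 6 * v 0 + v 1, θ ^ 3 * v 0 + v 1, θ ^ 2 * (v 2 + θ ^ 6 * v 3),
    θ * (v 2 + θ ^ 3 * v 3)]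
  map_add' v w := by
    ext j
    fin_cases j <;> simp <;> ring
  map_smul' c v := by
    ext j
    fin_cases j <;> simp <;> ring
  invFun v := ![v 0 + v 1, θ ^ 3 * v 0 + θ ^ 6 * v 1, θ ^ 10 * v 2 + θ ^ 14 * v 3,
    θ ^ 7 * v 2 + θ ^ 8 * v 3]
  left_inv v := by
    have h2 : (2 : K) = 0 := CharTwo.two_eq_zero
    ext j
    fin_cases j <;> simp <;> grind
  right_inv v := by
    have h2 : (2 : K) = 0 := CharTwo.two_eq_zero
    ext j
    fin_cases j <;> simp <;> grind

theorem eval_f₂_eq_fermat {θ : K} (hθ : θ ^ 6 + θ ^ 3 + 1 = 0) (v : Fin 4 → K) :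
    eval v (f₂ K) = fermatEquiv hθ v 0 ^ 3 + fermatEquiv hθ v 1 ^ 3 + fermatEquiv hθ v 2 ^ 3 +
      fermatEquiv hθ v 3 ^ 3 := by
  have h2 : (2 : K) = 0 := CharTwo.two_eq_zero
  simp [f₂, fermatEquiv]
  grind

theorem ncard_f₂_lines {θ : K} (hθ : θ ^ 6 + θ ^ 3 + 1 = 0) :
    {W : Submodule K (Fin 4 → K) | Module.finrank K W = 2 ∧
      ∀ v ∈ W, eval v (f₂ K) = 0}.ncard = 27 := by
  have hω : (θ ^ 3) ^ 2 + θ ^ 3 + 1 = 0 := by linear_combination hθ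
  rw [← ncard_fermat_lines hω]
  refine Set.ncard_congr (fun W _ => W.map (fermatEquiv hθ).toLinearMap) ?_ ?_ ?_
  · rintro W ⟨hr, hW⟩
    refine ⟨by rw [← hr]; exact LinearEquiv.finrank_map_eq (fermatEquiv hθ) W, ?_⟩
    rintro _ ⟨v, hv, rfl⟩
    rw [← hW v hv, eval_f₂_eq_fermat hθ]
    rfl
  · intro W W' _ _ h
    exact Submodule.map_injective_of_injective (fermatEquiv hθ).injective h
  · rintro W ⟨hr, hW⟩
    refine ⟨W.map (fermatEquiv hθ).symm.toLinearMap, ⟨?_, ?_⟩, ?_⟩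
    · rw [← hr]; exact LinearEquiv.finrank_map_eq (fermatEquiv hθ).symm W
    · rintro _ ⟨v, hv, rfl⟩
      rw [eval_f₂_eq_fermat hθ]
      simpa using hW v hv
    · rw [← Submodule.map_comp]
      simp

end CharTwo

theorem exists_primitive_ninth_root_F64 :
    ∃ θ : GaloisField 2 6, θ ^ 6 + θ ^ 3 + 1 = 0 := by
  classical
  obtain ⟨g, hg⟩ := IsCyclic.exists_ofOrder_eq_natCard (α := (GaloisField 2 6)ˣ)
  rw [Nat.card_units, GaloisField.card 2 6 (by norm_num)] at hg
  norm_num at hg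
  have h63 : (g : GaloisField 2 6) ^ 63 = 1 := by
    rw [← Units.val_pow_eq_pow_val, ← hg, pow_orderOf_eq_one, Units.val_one]
  have h21 : (g : GaloisField 2 6) ^ 21 ≠ 1 := by
    rw [← Units.val_pow_eq_pow_val, Ne, Units.val_eq_one]
    exact pow_ne_one_of_lt_orderOf (by norm_num) (by rw [hg]; norm_num)
  refine ⟨(g : GaloisField 2 6) ^ 7, ?_⟩
  refine (mul_eq_zero.1 ?_).resolve_left (sub_ne_zero.2 h21)
  linear_combination h63

/-- The cubic surface `S₂` splits over `𝔽₆₄`: all `27` of its lines are defined over the field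
with `64` elements, i.e. there are exactly `27` two-dimensional `𝔽₆₄`-linear subspaces of
`𝔽₆₄⁴` on which `f₂` vanishes identically. -/
theorem S₂_card_lines_over_F64 :
    {W : Submodule (GaloisField 2 6) (Fin 4 → GaloisField 2 6) |
        Module.finrank (GaloisField 2 6) W = 2
          ∧ ∀ v ∈ W, eval v (f₂ (GaloisField 2 6)) = 0}.ncard = 27 := by
  obtain ⟨θ, hθ⟩ := exists_primitive_ninth_root_F64
  exact ncard_f₂_lines hθ
end

section
/- For each θ ∈ 𝔽₄ with θ² + θ + 1 = 0, the cubic surface S₃(θ) contains no line defined over 𝔽₄ and no line defined over 𝔽₁₆: there is no 2-dimensional 𝔽₄-linear subspace of 𝔽₄⁴ on which f₃ vanishes identically, and no 2-dimensional 𝔽₁₆-linear subspace of 𝔽₁₆⁴ on which f₃ (with coefficients viewed in 𝔽₁₆ via an embedding 𝔽₄ → 𝔽₁₆) vanishes identically. -/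
open MvPolynomial

/-- The cubic form `X³ + Y³ + Z³ + θW³` with the variables `X, Y, Z, W` indexed by
`0, 1, 2, 3`, over any commutative ring `K` containing the coefficient `θ`. -/
noncomputable def f₃ (K : Type*) [CommRing K] (θ : K) : MvPolynomial (Fin 4) K :=
  X 0 ^ 3 + X 1 ^ 3 + X 2 ^ 3 + C θ * X 3 ^ 3

/-- Over a field of characteristic two, a primitive cube root of unity `w` recovers the mixed term
`p ^ 2 * q` from cubes. -/
lemma sq_mul_eq_sum_cubes {K : Type*} [Field K] [CharP K 2] {w : K} (hw : w ^ 2 + w + 1 = 0)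
    (p q : K) :
    p ^ 2 * q = (p + q) ^ 3 + w ^ 2 * (p + w * q) ^ 3 + w * (p + w ^ 2 * q) ^ 3 := by
  have h2 : (2 : K) = 0 := CharTwo.two_eq_zero
  grind

/-- If the diagonal cubic form with coefficients `a, b, c, d` vanishes on the span of
`(1, 0, x, y)` and `(0, 1, z, t)`, then its coefficients pair up modulo cubes. -/
lemma coeff_eq_mul_cube {K : Type*} [Field K] [CharP K 2] {a b c d x y z t : K}
    (ha : a ≠ 0) (hb : b ≠ 0) (hc : c ≠ 0) (hd : d ≠ 0)
    (h₁ : a + c * x ^ 3 + d * y ^ 3 = 0) (h₂ : b + c * z ^ 3 + d * t ^ 3 = 0)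
    (h₃ : c * (x ^ 2 * z) + d * (y ^ 2 * t) = 0) (h₄ : c * (z ^ 2 * x) + d * (t ^ 2 * y) = 0) :
    (∃ r s, r ≠ 0 ∧ s ≠ 0 ∧ a = c * r ^ 3 ∧ b = d * s ^ 3) ∨
      ∃ r s, r ≠ 0 ∧ s ≠ 0 ∧ a = d * r ^ 3 ∧ b = c * s ^ 3 := by
  have h2 : (2 : K) = 0 := CharTwo.two_eq_zero
  have hxz : x * z = 0 := by
    by_contra hne
    have hdet : x * t = y * z := by
      have : c * (x * z) * (x * t - y * z) = 0 := by linear_combination t * h₃ - y * h₄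
      simpa [hc, hne, sub_eq_zero] using this
    have : a * z = 0 := by
      linear_combination z * h₁ - x * h₃ + d * y ^ 2 * hdet
    simp_all
  have hyt : y * t = 0 := by
    by_contra hne
    have : d * (y * t) * y = 0 := by linear_combination h₃ - c * x * hxz
    simp_all
  rcases mul_eq_zero.mp hxz with rfl | rfl <;> rcases mul_eq_zero.mp hyt with rfl | rfl
  · simp_all
  · refine .inr ⟨y, z, ?_, ?_, ?_, ?_⟩
    · rintro rfl; simp_all
    · rintro rfl; simp_all
    · linear_combination h₁ - d * y ^ 3 * h2
    · linear_combination h₂ - c * z ^ 3 * h2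
  · refine .inl ⟨x, t, ?_, ?_, ?_, ?_⟩
    · rintro rfl; simp_all
    · rintro rfl; simp_all
    · linear_combination h₁ - c * x ^ 3 * h2
    · linear_combination h₂ - d * t ^ 3 * h2
  · simp_all

/-- A two-dimensional space of vectors contains a basis in reduced form with respect to some pair
of coordinates. -/
lemma exists_reduced_pair {K ι : Type*} [Field K] (W : Submodule K (ι → K))
    (hW : Module.finrank K W = 2) :
    ∃ i j, i ≠ j ∧ ∃ u ∈ W, ∃ v ∈ W, u i = 1 ∧ u j = 0 ∧ v i = 0 ∧ v j = 1 := by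
  have : Module.Finite K W := Module.finite_of_finrank_pos (by omega)
  let B := Module.finBasisOfFinrankEq K W hW
  have hli : LinearIndependent K ![(B 0 : ι → K), (B 1 : ι → K)] := by
    have := B.linearIndependent.map' W.subtype W.ker_subtype
    have hB : W.subtype ∘ B = ![(B 0 : ι → K), (B 1 : ι → K)] := by
      ext k
      fin_cases k <;> rfl
    rwa [hB] at this
  have hu := (B 0).2
  have hv := (B 1).2
  generalize (B 0 : ι → K) = u at hli hu
  generalize (B 1 : ι → K) = v at hli hv
  obtain ⟨i, j, hij⟩ : ∃ i j, u i * v j - u j * v i ≠ 0 := by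
    by_contra! h
    obtain ⟨i, hi⟩ := Function.ne_iff.mp (hli.ne_zero 0)
    refine hi ?_
    refine neg_eq_zero.mp (LinearIndependent.pair_iff.mp hli (v i) (-u i) ?_).2
    ext j
    simp only [Pi.add_apply, Pi.smul_apply, smul_eq_mul, Pi.zero_apply]
    linear_combination -h i j
  refine ⟨i, j, ?_, (u i * v j - u j * v i)⁻¹ • (v j • u - u j • v),
    W.smul_mem _ (W.sub_mem (W.smul_mem _ hu) (W.smul_mem _ hv)),
    (u i * v j - u j * v i)⁻¹ • (u i • v - v i • u),
    W.smul_mem _ (W.sub_mem (W.smul_mem _ hv) (W.smul_mem _ hu)), ?_, ?_, ?_, ?_⟩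
  · rintro rfl
    exact hij (sub_self _)
  all_goals
    simp only [Pi.sub_apply, Pi.smul_apply, smul_eq_mul]
    rw [inv_mul_eq_iff_eq_mul₀ hij]
    ring

/-- The surface `f₃ = 0` contains no line over a field of characteristic two in which the
primitive cube root of unity `θ` is not a cube. -/
lemma not_exists_line_of_not_cube {K : Type*} [Field K] [CharP K 2] {θ : K}
    (hθ : θ ^ 2 + θ + 1 = 0) (hcube : ∀ x : K, x ^ 3 ≠ θ) :
    ¬ ∃ W : Submodule K (Fin 4 → K),
      Module.finrank K W = 2 ∧ ∀ v ∈ W, eval v (f₃ K θ) = 0 := by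
  rintro ⟨W, hW, hf⟩
  have hf' (v) (hv : v ∈ W) : v 0 ^ 3 + v 1 ^ 3 + v 2 ^ 3 + θ * v 3 ^ 3 = 0 := by
    simpa [f₃] using hf v hv
  have hmixed (u v) (hu : u ∈ W) (hv : v ∈ W) :
      u 0 ^ 2 * v 0 + u 1 ^ 2 * v 1 + u 2 ^ 2 * v 2 + θ * (u 3 ^ 2 * v 3) = 0 := by
    have h₀ := hf' _ (W.add_mem hu hv)
    have h₁ := hf' _ (W.add_mem hu (W.smul_mem θ hv))
    have h₂ := hf' _ (W.add_mem hu (W.smul_mem (θ ^ 2) hv))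
    simp only [Pi.add_apply, Pi.smul_apply, smul_eq_mul] at h₀ h₁ h₂
    rw [sq_mul_eq_sum_cubes hθ (u 0), sq_mul_eq_sum_cubes hθ (u 1),
      sq_mul_eq_sum_cubes hθ (u 2), sq_mul_eq_sum_cubes hθ (u 3)]
    linear_combination h₀ + θ ^ 2 * h₁ + θ * h₂
  have hθ₀ : θ ≠ 0 := by rintro rfl; simp at hθ
  have hcube₁ (r : K) : θ ≠ r ^ 3 := (hcube r).symm
  have hcube₂ (r : K) (hr : r ≠ 0) : 1 ≠ θ * r ^ 3 := fun h ↦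
    hcube r⁻¹ (by rw [inv_pow]; exact (eq_inv_of_mul_eq_one_left h.symm).symm)
  obtain ⟨i, j, hij, u, hu, v, hv, hui, huj, hvi, hvj⟩ := exists_reduced_pair W hW
  let a : Fin 4 → K := ![1, 1, 1, θ]
  have ha (m) : a m ≠ 0 := by fin_cases m <;> simp [a, hθ₀]
  have hne (m n : Fin 4) (hmn : m ≠ n) (h3 : m = 3 ∨ n = 3) (r : K) (hr : r ≠ 0) :
      a m ≠ a n * r ^ 3 := by
    fin_cases m <;> fin_cases n <;> simp_all [a]
  obtain ⟨σ, rfl, rfl⟩ : ∃ σ : Equiv.Perm (Fin 4), σ 0 = i ∧ σ 1 = j := by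
    clear * - hij
    revert i j
    decide
  have hsum (F : Fin 4 → K) (hF : a 0 * F 0 + a 1 * F 1 + a 2 * F 2 + a 3 * F 3 = 0) :
      a (σ 0) * F (σ 0) + a (σ 1) * F (σ 1) + a (σ 2) * F (σ 2) + a (σ 3) * F (σ 3) = 0 := by
    have := Equiv.sum_comp σ fun m ↦ a m * F m
    simp only [Fin.sum_univ_four] at this
    rw [this, hF]
  have h₁ := hsum (fun m ↦ u m ^ 3) (by simpa [a] using hf' u hu)
  have h₂ := hsum (fun m ↦ v m ^ 3) (by simpa [a] using hf' v hv)
  have h₃ := hsum (fun m ↦ u m ^ 2 * v m) (by simpa [a] using hmixed u v hu hv)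
  have h₄ := hsum (fun m ↦ v m ^ 2 * u m) (by simpa [a] using hmixed v u hv hu)
  simp only [hui, huj, hvi, hvj] at h₁ h₂ h₃ h₄
  obtain ⟨m, hm⟩ := σ.surjective 3
  rcases coeff_eq_mul_cube (ha (σ 0)) (ha (σ 1)) (ha (σ 2)) (ha (σ 3)) (by simpa using h₁)
    (by simpa using h₂) (by simpa using h₃) (by simpa using h₄) with
    ⟨r, s, hr, hs, h, h'⟩ | ⟨r, s, hr, hs, h, h'⟩
  · have H₁ := fun h3 ↦ hne _ _ (σ.injective.ne (by decide)) h3 r hr h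
    have H₂ := fun h3 ↦ hne _ _ (σ.injective.ne (by decide)) h3 s hs h'
    fin_cases m
    exacts [H₁ (.inl hm), H₂ (.inl hm), H₁ (.inr hm), H₂ (.inr hm)]
  · have H₁ := fun h3 ↦ hne _ _ (σ.injective.ne (by decide)) h3 r hr h
    have H₂ := fun h3 ↦ hne _ _ (σ.injective.ne (by decide)) h3 s hs h'
    fin_cases m
    exacts [H₁ (.inl hm), H₂ (.inl hm), H₂ (.inr hm), H₁ (.inr hm)]

/-- A primitive cube root of unity is not a cube in a field of characteristic two all of whose
elements satisfy `x ^ 16 = x`. -/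
lemma cube_ne_of_pow_sixteen {K : Type*} [Field K] [CharP K 2] {θ : K}
    (hθ : θ ^ 2 + θ + 1 = 0) (hK : ∀ x : K, x ^ 16 = x) (x : K) : x ^ 3 ≠ θ := by
  rintro rfl
  have hx : x ≠ 0 := by rintro rfl; simp at hθ
  have h15 : x ^ 15 = 1 := mul_right_cancel₀ hx (by linear_combination hK x)
  have h9 : x ^ 9 = 1 := by linear_combination (x ^ 3 - 1) * hθ
  have h6 : x ^ 6 = 1 := by linear_combination h15 - x ^ 6 * h9
  have h2 : (2 : K) = 0 := CharTwo.two_eq_zero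
  exact one_ne_zero (α := K) (by linear_combination hθ - h9 + (x ^ 3 - 1) * h6 - h2)

/-- For each `θ ∈ 𝔽₄` with `θ² + θ + 1 = 0`, the cubic surface `S₃(θ)` contains no line
defined over `𝔽₄` and no line defined over `𝔽₁₆`. -/
theorem S₃_no_line_over_F4_or_F16 (θ : GaloisField 2 2) (hθ : θ ^ 2 + θ + 1 = 0) :
    (¬ ∃ W : Submodule (GaloisField 2 2) (Fin 4 → GaloisField 2 2),
        Module.finrank (GaloisField 2 2) W = 2
          ∧ ∀ v ∈ W, eval v (f₃ (GaloisField 2 2) θ) = 0)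
      ∧ ∀ ι : GaloisField 2 2 →+* GaloisField 2 4,
          ¬ ∃ W : Submodule (GaloisField 2 4) (Fin 4 → GaloisField 2 4),
              Module.finrank (GaloisField 2 4) W = 2
                ∧ ∀ v ∈ W, eval v (f₃ (GaloisField 2 4) (ι θ)) = 0 := by
  have h₄ (x : GaloisField 2 2) : x ^ 4 = x := by
    have := Fintype.ofFinite (GaloisField 2 2)
    simpa [← Nat.card_eq_fintype_card, GaloisField.card] using FiniteField.pow_card x
  have h₁₆ (x : GaloisField 2 4) : x ^ 16 = x := by
    have := Fintype.ofFinite (GaloisField 2 4)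
    simpa [← Nat.card_eq_fintype_card, GaloisField.card] using FiniteField.pow_card x
  refine ⟨not_exists_line_of_not_cube hθ (cube_ne_of_pow_sixteen hθ fun x ↦ ?_), fun ι ↦ ?_⟩
  · rw [show 16 = 4 * 4 by rfl, pow_mul, h₄, h₄]
  · have hι : ι θ ^ 2 + ι θ + 1 = 0 := by simpa using congrArg ι hθ
    exact not_exists_line_of_not_cube hι (cube_ne_of_pow_sixteen hι h₁₆)
end
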